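/- Let ψ be a cylinder function, t ≥ 0 with P(t) = 0, and let μ be an ergodic t-equilibrium measure. Then dim_ψ(I^∞) = t, and every Borel set A ⊂ I^∞ with μ(A) = 1 satisfies dim_ψ(A) = dim_ψ(I^∞) = t. -/

import Mathlib

open Filter Topology MeasureTheory

/-- The cylinder set `[w] ⊆ I^∞` determined by a finite word `w`. -/
def cyl {I : Type*} (w : List I) : Set (ℕ → I) :=
  {x | ∀ k : Fin w.length, x k = w.get k}

/-- The left shift `σ : I^∞ → I^∞`. -/
def shift {I : Type*} (x : ℕ → I) : ℕ → I := fun n => x (n + 1)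

/-- The concatenation `w,x ∈ I^∞` of a finite word `w` with an infinite word `x`. -/
def wcat {I : Type*} (w : List I) (x : ℕ → I) : ℕ → I := fun n =>
  if h : n < w.length then w.get ⟨n, h⟩ else x (n - w.length)

/-- The word `x|_n` consisting of the first `n` letters of `x ∈ I^∞`. -/
def pref {I : Type*} (x : ℕ → I) (n : ℕ) : List I := List.ofFn (fun k : Fin n => x k)

/-- A *cylinder function*: a family `ψ t w : I^∞ → (0,∞)` for `t ≥ 0` and nonempty words `w`,
satisfying the bounded variation principle (with constant `K t ≥ 1`), the subchain rule, and
comparability in the parameter `t` with constants `0 < slo, shi < 1`. -/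
structure CylFun (I : Type*) where
  ψ : ℝ → List I → (ℕ → I) → ℝ
  K : ℝ → ℝ
  slo : ℝ
  shi : ℝ
  pos : ∀ t : ℝ, 0 ≤ t → ∀ w : List I, w ≠ [] → ∀ h : ℕ → I, 0 < ψ t w h
  one_le_K : ∀ t : ℝ, 0 ≤ t → 1 ≤ K t
  bvp : ∀ t : ℝ, 0 ≤ t → ∀ w : List I, w ≠ [] → ∀ h j : ℕ → I, ψ t w h ≤ K t * ψ t w j
  subchain : ∀ t : ℝ, 0 ≤ t → ∀ w : List I, ∀ j : ℕ, 1 ≤ j → j < w.length → ∀ h : ℕ → I,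
    ψ t w h ≤ ψ t (w.take j) (wcat (w.drop j) h) * ψ t (w.drop j) h
  slo_pos : 0 < slo
  slo_lt_one : slo < 1
  shi_pos : 0 < shi
  shi_lt_one : shi < 1
  le_param : ∀ t : ℝ, 0 ≤ t → ∀ δ : ℝ, 0 ≤ δ → ∀ w : List I, w ≠ [] → ∀ h : ℕ → I,
    ψ t w h * slo ^ (δ * (w.length : ℝ)) ≤ ψ (t + δ) w h
  param_le : ∀ t : ℝ, 0 ≤ t → ∀ δ : ℝ, 0 ≤ δ → ∀ w : List I, w ≠ [] → ∀ h : ℕ → I,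
    ψ (t + δ) w h ≤ ψ t w h * shi ^ (δ * (w.length : ℝ))

/-- A Borel probability measure on `I^∞` is (shift-)invariant if `μ [w] = μ (σ⁻¹ [w])`
for every finite word `w`. -/
def IsShiftInvariant {I : Type*} [MeasurableSpace I] (μ : Measure (ℕ → I)) : Prop :=
  ∀ w : List I, w ≠ [] → μ (cyl w) = μ (shift ⁻¹' cyl w)

/-- A measure on `I^∞` is ergodic if every Borel set `A` with `σ⁻¹ A = A` is null or conull. -/
def IsShiftErgodic {I : Type*} [MeasurableSpace I] (μ : Measure (ℕ → I)) : Prop :=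
  ∀ A : Set (ℕ → I), MeasurableSet A → shift ⁻¹' A = A → μ A = 0 ∨ μ A = 1

section seqs

variable {I : Type*} [Fintype I] [MeasurableSpace I]

/-- `(1/n) log ∑_{i ∈ Iⁿ} ψᵢᵗ(h)`: the sequence defining the topological pressure `P(t)`. -/
noncomputable def presSeq (C : CylFun I) (t : ℝ) (h : ℕ → I) (n : ℕ) : ℝ :=
  (n : ℝ)⁻¹ * Real.log (∑ f : Fin n → I, C.ψ t (List.ofFn f) h)

/-- `-(1/n) ∑_{i ∈ Iⁿ} μ[i] log μ[i]`: the sequence defining the entropy `h_μ`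
(with the convention `0 · log 0 = 0`, automatic since `Real.log 0 = 0`). -/
noncomputable def entSeq (μ : Measure (ℕ → I)) (n : ℕ) : ℝ :=
  -((n : ℝ)⁻¹ * ∑ f : Fin n → I,
      (μ (cyl (List.ofFn f))).toReal * Real.log (μ (cyl (List.ofFn f))).toReal)

/-- `(1/n) ∑_{i ∈ Iⁿ} μ[i] log ψᵢᵗ(h)`: the sequence defining the energy `E_μ(t)`. -/
noncomputable def enSeq (μ : Measure (ℕ → I)) (C : CylFun I) (t : ℝ) (h : ℕ → I) (n : ℕ) : ℝ :=
  (n : ℝ)⁻¹ * ∑ f : Fin n → I,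
    (μ (cyl (List.ofFn f))).toReal * Real.log (C.ψ t (List.ofFn f) h)

end seqs

section dim

variable {I : Type*}

open scoped ENNReal

/-- The pre-measure `G_n^t(A)`: infimum of `∑_j ψ_{i_j}^t(h)` over countable covers of `A`
by cylinders of level at least `n`. -/
noncomputable def Gpre (C : CylFun I) (t : ℝ) (h : ℕ → I) (n : ℕ) (A : Set (ℕ → I)) : ℝ≥0∞ :=
  ⨅ (c : ℕ → List I) (_ : A ⊆ ⋃ j : ℕ, cyl (c j)) (_ : ∀ j : ℕ, n ≤ (c j).length),
    ∑' j : ℕ, ENNReal.ofReal (C.ψ t (c j) h)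

/-- The measure `G^t(A) = lim_{n→∞} G_n^t(A)` from Carathéodory's construction. -/
noncomputable def Gmeas (C : CylFun I) (t : ℝ) (h : ℕ → I) (A : Set (ℕ → I)) : ℝ≥0∞ :=
  ⨆ n : ℕ, Gpre C t h n A

/-- The equilibrium dimension `dim_ψ(A) = inf { t ≥ 0 : G^t(A) = 0 }`. -/
noncomputable def eqDim (C : CylFun I) (h : ℕ → I) (A : Set (ℕ → I)) : ℝ :=
  sInf {t : ℝ | 0 ≤ t ∧ Gmeas C t h A = 0}

end dim

section words

variable {I : Type*}

lemma sum_ofFn_succ [Fintype I] (n : ℕ) (F : List I → ℝ) :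
    ∑ f : Fin (n + 1) → I, F (List.ofFn f) =
      ∑ a : I, ∑ f : Fin n → I, F (a :: List.ofFn f) := by
  rw [← (Fin.consEquiv (fun _ : Fin (n + 1) => I)).sum_comp, Fintype.sum_prod_type]
  simp [Fin.consEquiv, List.ofFn_succ]

open Classical in
lemma sum_prefix_le_one [Fintype I] {F : List I → ℝ}
    (hF : ∀ n, ∑ f : Fin n → I, F (List.ofFn f) ≤ 1) (w : List I) (n : ℕ) :
    ∑ f : Fin n → I,
      (if w <+: List.ofFn f then F ((List.ofFn f).drop w.length) else 0) ≤ 1 := by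
  induction w generalizing n with
  | nil => simpa using hF n
  | cons a w ih =>
    cases n with
    | zero => simp
    | succ n =>
      rw [sum_ofFn_succ n (fun l => if a :: w <+: l then F (l.drop (a :: w).length) else 0)]
      rw [Finset.sum_eq_single a]
      · simpa [List.cons_prefix_cons] using ih n
      · intro b _ hb
        simp [List.cons_prefix_cons, hb.symm]
      · simp

open Classical in
/-- The total weight of the ways of cutting a word into at most `k` pieces, each of which is
either a single letter, of weight `b`, or a word `w ∈ S`, of weight `a w`. -/
noncomputable def parseWeight (b : ℝ) (a : List I → ℝ) (S : Finset (List I)) :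
    ℕ → List I → ℝ
  | _, [] => 1
  | 0, _ :: _ => 0
  | k + 1, i :: l => b * parseWeight b a S k l +
      ∑ w ∈ S, if w <+: i :: l then a w * parseWeight b a S k ((i :: l).drop w.length) else 0

open Classical in
/-- The number of nonempty tails of a word that have no prefix in `S`. -/
noncomputable def missCount (S : Finset (List I)) : List I → ℕ
  | [] => 0
  | i :: l => (if ∃ w ∈ S, w <+: i :: l then 0 else 1) + missCount S l

lemma parseWeight_nonneg {b : ℝ} {a : List I → ℝ} {S : Finset (List I)} (hb : 0 ≤ b)
    (ha : ∀ w ∈ S, 0 ≤ a w) (k : ℕ) (l : List I) : 0 ≤ parseWeight b a S k l := by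
  induction k generalizing l with
  | zero => cases l <;> simp [parseWeight]
  | succ k ih =>
    cases l with
    | nil => simp [parseWeight]
    | cons i l =>
      rw [parseWeight]
      refine add_nonneg (mul_nonneg hb (ih _)) (Finset.sum_nonneg fun w hw => ?_)
      split_ifs
      · exact mul_nonneg (ha w hw) (ih _)
      · exact le_rfl

lemma sum_parseWeight_le_one [Fintype I] {b : ℝ} {a : List I → ℝ} {S : Finset (List I)}
    (hb : 0 ≤ b) (ha : ∀ w ∈ S, 0 ≤ a w)
    (hab : Fintype.card I * b + ∑ w ∈ S, a w ≤ 1) (k n : ℕ) :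
    ∑ f : Fin n → I, parseWeight b a S k (List.ofFn f) ≤ 1 := by
  classical
  induction k generalizing n with
  | zero =>
    cases n with
    | zero => simp [parseWeight]
    | succ n => simp [List.ofFn_succ, parseWeight]
  | succ k ih =>
    cases n with
    | zero => simp [parseWeight]
    | succ n =>
      have h1 : ∑ f : Fin (n + 1) → I, parseWeight b a S (k + 1) (List.ofFn f) =
          Fintype.card I * (b * ∑ f : Fin n → I, parseWeight b a S k (List.ofFn f)) +
          ∑ w ∈ S, a w * ∑ f : Fin (n + 1) → I, (if w <+: List.ofFn f then
            parseWeight b a S k ((List.ofFn f).drop w.length) else 0) := by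
        have h2 : ∀ f : Fin (n + 1) → I, parseWeight b a S (k + 1) (List.ofFn f) =
            b * parseWeight b a S k ((List.ofFn f).tail) +
            ∑ w ∈ S, a w * (if w <+: List.ofFn f then
              parseWeight b a S k ((List.ofFn f).drop w.length) else 0) := by
          intro f
          rw [List.ofFn_succ, parseWeight]
          simp only [mul_ite, mul_zero, List.tail_cons]
        simp only [h2, Finset.sum_add_distrib]
        rw [Finset.sum_comm]
        congr 1
        · rw [sum_ofFn_succ n (fun l => b * parseWeight b a S k l.tail)]
          simp [Finset.mul_sum]
        · simp only [Finset.mul_sum]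
      rw [h1]
      refine le_trans (add_le_add ?_ (Finset.sum_le_sum fun w hw => ?_)) hab
      · exact mul_le_mul_of_nonneg_left
          (mul_le_of_le_one_right hb (ih n)) (Nat.cast_nonneg _)
      · exact mul_le_of_le_one_right (ha w hw) (sum_prefix_le_one ih w _)

lemma missCount_le_append (S : Finset (List I)) (w u : List I) :
    missCount S u ≤ missCount S (w ++ u) := by
  induction w with
  | nil => simp
  | cons i w ih =>
    rw [List.cons_append, missCount]
    omega

lemma le_parseWeight {p : List I → ℝ} {D r b : ℝ} {S : Finset (List I)}
    (hp : ∀ w, 0 < p w) (hnil : p [] = 1) (hmul : ∀ u v, p (u ++ v) ≤ p u * p v)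
    (hD : 0 < D) (hr : 0 < r) (hr1 : r ≤ 1) (hb : ∀ i, p [i] * D * r ≤ b) (hb0 : 0 ≤ b)
    (hS : ∀ w ∈ S, w ≠ []) (k : ℕ) (l : List I) (hk : l.length ≤ k) :
    p l * D ^ l.length * r ^ missCount S l ≤
      parseWeight b (fun w => p w * D ^ w.length) S k l := by
  have hQ := parseWeight_nonneg (S := S) (a := fun w => p w * D ^ w.length) hb0
    (fun w _ => mul_nonneg (hp w).le (pow_nonneg hD.le _))
  induction k generalizing l with
  | zero =>
    obtain rfl : l = [] := List.length_eq_zero_iff.1 (by omega)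
    simp [missCount, parseWeight, hnil]
  | succ k ih =>
    cases l with
    | nil => simp [missCount, parseWeight, hnil]
    | cons i l =>
      have hterm : ∀ w ∈ S, 0 ≤ (open Classical in if w <+: i :: l then
          p w * D ^ w.length * parseWeight b (fun w => p w * D ^ w.length) S k
            ((i :: l).drop w.length) else 0) := by
        intro w _
        split_ifs
        · exact mul_nonneg (mul_nonneg (hp w).le (pow_nonneg hD.le _)) (hQ _ _)
        · exact le_rfl
      rw [parseWeight]
      by_cases hex : ∃ w ∈ S, w <+: i :: l
      · obtain ⟨w, hw, hwl⟩ := hex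
        refine le_trans ?_ (le_add_of_nonneg_left (mul_nonneg hb0 (hQ _ _)))
        refine le_trans ?_ (Finset.single_le_sum hterm hw)
        rw [if_pos hwl]
        obtain ⟨u, hu⟩ := hwl
        rw [← hu, List.drop_left]
        have hlen : 1 ≤ w.length := List.length_pos_iff.2 (hS w hw)
        have hlen' : w.length + u.length = l.length + 1 := by
          simpa using congrArg List.length hu
        have hku : u.length ≤ k := by
          simp only [List.length_cons] at hk
          omega
        calc p (w ++ u) * D ^ (w ++ u).length * r ^ missCount S (w ++ u)
            ≤ (p w * p u) * D ^ (w ++ u).length * r ^ missCount S u := by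
              refine mul_le_mul (mul_le_mul_of_nonneg_right (hmul w u) (pow_nonneg hD.le _))
                (pow_le_pow_of_le_one hr.le hr1 (missCount_le_append S w u))
                (pow_nonneg hr.le _) ?_
              exact mul_nonneg (mul_nonneg (hp w).le (hp u).le) (pow_nonneg hD.le _)
          _ = p w * D ^ w.length * (p u * D ^ u.length * r ^ missCount S u) := by
              rw [List.length_append, pow_add]; ring
          _ ≤ _ := mul_le_mul_of_nonneg_left (ih u hku)
              (mul_nonneg (hp w).le (pow_nonneg hD.le _))
      · refine le_trans ?_ (le_add_of_nonneg_right (Finset.sum_nonneg hterm))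
        have hkl : l.length ≤ k := by simpa using hk
        rw [missCount, if_neg hex]
        calc p (i :: l) * D ^ (i :: l).length * r ^ (1 + missCount S l)
            ≤ (p [i] * p l) * D ^ (i :: l).length * r ^ (1 + missCount S l) := by
              gcongr ?_ * _ * _
              exact hmul [i] l
          _ = (p [i] * D * r) * (p l * D ^ l.length * r ^ missCount S l) := by
              rw [List.length_cons, pow_add, pow_succ]; ring
          _ ≤ b * (p l * D ^ l.length * r ^ missCount S l) :=
              mul_le_mul_of_nonneg_right (hb i)
                (mul_nonneg (mul_nonneg (hp l).le (pow_nonneg hD.le _)) (pow_nonneg hr.le _))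
          _ ≤ _ := mul_le_mul_of_nonneg_left (ih l hkl) hb0

/-- Gibbs' inequality, for `q` of total mass at most that of `m`. -/
lemma sum_mul_log_le {ι : Type*} (s : Finset ι) {m q : ι → ℝ} (hm : ∀ i ∈ s, 0 ≤ m i)
    (hq : ∀ i ∈ s, 0 < q i) (hmq : ∑ i ∈ s, q i ≤ ∑ i ∈ s, m i) :
    ∑ i ∈ s, m i * Real.log (q i) ≤ ∑ i ∈ s, m i * Real.log (m i) := by
  have key : ∀ i ∈ s, m i * Real.log (q i) - m i * Real.log (m i) ≤ q i - m i := by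
    intro i hi
    rcases (hm i hi).eq_or_lt with h0 | h0
    · simp [← h0, (hq i hi).le]
    · have h1 := Real.log_le_sub_one_of_pos (div_pos (hq i hi) h0)
      rw [Real.log_div (hq i hi).ne' h0.ne'] at h1
      have h2 := mul_le_mul_of_nonneg_left h1 h0.le
      have h3 : m i * (q i / m i - 1) = q i - m i := by field_simp
      linarith
  have := Finset.sum_le_sum key
  simp only [Finset.sum_sub_distrib] at this
  linarith

open Classical in
/-- The expected number of tails without a prefix in `S`, for stationary weights `m`. -/
lemma sum_missCount_le [Fintype I] {m : List I → ℝ} {S : Finset (List I)} {ε : ℝ} {M : ℕ}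
    (hm : ∀ l, 0 ≤ m l) (hm1 : ∀ n, ∑ f : Fin n → I, m (List.ofFn f) = 1)
    (hcons : ∀ l, ∑ a, m (a :: l) = m l) (hε : 0 ≤ ε)
    (hbad : ∀ n, M ≤ n → ∑ f : Fin n → I,
      (if ∃ w ∈ S, w <+: List.ofFn f then 0 else m (List.ofFn f)) ≤ ε) (n : ℕ) :
    ∑ f : Fin n → I, m (List.ofFn f) * missCount S (List.ofFn f) ≤ M + ε * n := by
  suffices h : ∑ f : Fin n → I, m (List.ofFn f) * missCount S (List.ofFn f) ≤
      (min n M : ℕ) + ε * n by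
    have : ((min n M : ℕ) : ℝ) ≤ M := by exact_mod_cast min_le_right _ _
    linarith
  induction n with
  | zero => simp [missCount]
  | succ n ih =>
    have h1 : ∑ f : Fin (n + 1) → I, m (List.ofFn f) * missCount S (List.ofFn f) =
        (∑ f : Fin (n + 1) → I,
          (if ∃ w ∈ S, w <+: List.ofFn f then 0 else m (List.ofFn f))) +
        ∑ f : Fin n → I, m (List.ofFn f) * missCount S (List.ofFn f) := by
      have h2 : ∀ f : Fin (n + 1) → I, m (List.ofFn f) * missCount S (List.ofFn f) =
          (if ∃ w ∈ S, w <+: List.ofFn f then 0 else m (List.ofFn f)) +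
          m (List.ofFn f) * missCount S (List.ofFn f).tail := by
        intro f
        rw [List.ofFn_succ, missCount]
        split_ifs <;> simp [mul_add]
      simp only [h2, Finset.sum_add_distrib]
      congr 1
      rw [sum_ofFn_succ n (fun l => m l * missCount S l.tail), Finset.sum_comm]
      simp [← Finset.sum_mul, hcons]
    rw [h1]
    rcases le_or_gt M (n + 1) with hM | hM
    · have h2 := hbad (n + 1) hM
      have h3 : ((min n M : ℕ) : ℝ) ≤ (min (n + 1) M : ℕ) := by
        exact_mod_cast min_le_min_right _ (Nat.le_succ n)
      push_cast at *
      linarith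
    · have h2 : ∑ f : Fin (n + 1) → I,
          (if ∃ w ∈ S, w <+: List.ofFn f then 0 else m (List.ofFn f)) ≤ 1 := by
        rw [← hm1 (n + 1)]
        refine Finset.sum_le_sum fun f _ => ?_
        split_ifs
        · exact hm _
        · exact le_rfl
      rw [min_eq_left (by omega : n ≤ M)] at ih
      rw [min_eq_left hM.le]
      push_cast
      linarith

/-- Entropy bound for stationary weights `m`, most of whose mass lies on words beginning with
an element of `S`. -/
lemma sum_log_le_of_parse [Fintype I] {m p : List I → ℝ} {D r b ε : ℝ} {M : ℕ}
    {S : Finset (List I)}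
    (hm : ∀ l, 0 ≤ m l) (hm1 : ∀ n, ∑ f : Fin n → I, m (List.ofFn f) = 1)
    (hcons : ∀ l, ∑ a, m (a :: l) = m l) (hε : 0 ≤ ε)
    (hbad : ∀ n, M ≤ n → ∑ f : Fin n → I,
      (open Classical in if ∃ w ∈ S, w <+: List.ofFn f then 0 else m (List.ofFn f)) ≤ ε)
    (hp : ∀ w, 0 < p w) (hnil : p [] = 1) (hmul : ∀ u v, p (u ++ v) ≤ p u * p v)
    (hD : 0 < D) (hr : 0 < r) (hr1 : r ≤ 1) (hb : ∀ i, p [i] * D * r ≤ b) (hb0 : 0 ≤ b)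
    (hS : ∀ w ∈ S, w ≠ [])
    (hab : Fintype.card I * b + ∑ w ∈ S, p w * D ^ w.length ≤ 1) (n : ℕ) :
    ∑ f : Fin n → I, m (List.ofFn f) * Real.log (p (List.ofFn f)) + n * Real.log D
      + Real.log r * (M + ε * n) ≤
    ∑ f : Fin n → I, m (List.ofFn f) * Real.log (m (List.ofFn f)) := by
  have hlow : ∀ f : Fin n → I, p (List.ofFn f) * D ^ n * r ^ missCount S (List.ofFn f) ≤
      parseWeight b (fun w => p w * D ^ w.length) S n (List.ofFn f) := by
    intro f
    simpa using le_parseWeight hp hnil hmul hD hr hr1 hb hb0 hS n (List.ofFn f) (by simp)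
  have hpos : ∀ f : Fin n → I,
      0 < p (List.ofFn f) * D ^ n * r ^ missCount S (List.ofFn f) := fun f =>
    mul_pos (mul_pos (hp _) (pow_pos hD _)) (pow_pos hr _)
  refine le_trans ?_ (sum_mul_log_le Finset.univ (fun f _ => hm (List.ofFn f))
    (fun f _ => hpos f) ?_)
  · have h1 : ∀ f : Fin n → I, m (List.ofFn f) *
        Real.log (p (List.ofFn f) * D ^ n * r ^ missCount S (List.ofFn f)) =
        m (List.ofFn f) * Real.log (p (List.ofFn f)) + m (List.ofFn f) * (n * Real.log D) +
        Real.log r * (m (List.ofFn f) * missCount S (List.ofFn f)) := by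
      intro f
      rw [Real.log_mul (mul_pos (hp _) (pow_pos hD _)).ne' (pow_pos hr _).ne',
        Real.log_mul (hp _).ne' (pow_pos hD _).ne', Real.log_pow, Real.log_pow]
      ring
    simp only [h1, Finset.sum_add_distrib, ← Finset.sum_mul, ← Finset.mul_sum, hm1, one_mul]
    have h2 := mul_le_mul_of_nonpos_left (sum_missCount_le hm hm1 hcons hε hbad n)
      (Real.log_nonpos hr.le hr1)
    linarith
  · rw [hm1]
    exact (Finset.sum_le_sum fun f _ => hlow f).trans (sum_parseWeight_le_one hb0
      (fun w _ => mul_nonneg (hp w).le (pow_nonneg hD.le _)) hab n n)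

end words

section cylinders

variable {I : Type*}

lemma mem_cyl_cons {a : I} {l : List I} {x : ℕ → I} :
    x ∈ cyl (a :: l) ↔ x 0 = a ∧ shift x ∈ cyl l := by
  constructor
  · intro hx
    exact ⟨hx ⟨0, by simp⟩, fun k => hx ⟨k + 1, by simp⟩⟩
  · rintro ⟨h0, h1⟩ ⟨k, hk⟩
    cases k with
    | zero => exact h0
    | succ k => exact h1 ⟨k, by simpa using hk⟩

lemma cyl_nil : cyl ([] : List I) = Set.univ :=
  Set.eq_univ_of_forall fun _ k => absurd k.2 (by simp)

lemma mem_cyl_ofFn {n : ℕ} {f : Fin n → I} {x : ℕ → I} :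
    x ∈ cyl (List.ofFn f) ↔ ∀ k : Fin n, x k = f k := by
  constructor
  · intro hx k
    simpa using hx ⟨k, by simp⟩
  · intro hx k
    simpa using hx ⟨k, by simpa using k.2⟩

lemma prefix_of_mem_cyl {w l : List I} {x : ℕ → I} (hw : x ∈ cyl w) (hl : x ∈ cyl l)
    (hlen : w.length ≤ l.length) : w <+: l := by
  induction w generalizing l x with
  | nil => simp
  | cons a w ih =>
    cases l with
    | nil => simp at hlen
    | cons b l =>
      rw [mem_cyl_cons] at hw hl
      exact List.cons_prefix_cons.2 ⟨hw.1.symm.trans hl.1, ih hw.2 hl.2 (by simpa using hlen)⟩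

variable [MeasurableSpace I] [DiscreteMeasurableSpace I]

lemma measurableSet_cyl (w : List I) : MeasurableSet (cyl w) := by
  have : cyl w = ⋂ k : Fin w.length, (fun x : ℕ → I => x k) ⁻¹' {w.get k} := by
    ext x; simp [cyl]
  rw [this]
  exact MeasurableSet.iInter fun k => measurable_pi_apply _ (MeasurableSet.of_discrete)

lemma sum_measureReal_cyl_cons [Fintype I] {μ : Measure (ℕ → I)} [IsProbabilityMeasure μ]
    (hinv : IsShiftInvariant μ) (l : List I) :
    ∑ a, (μ (cyl (a :: l))).toReal = (μ (cyl l)).toReal := by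
  have h1 : μ (cyl l) = μ (shift ⁻¹' cyl l) := by
    rcases eq_or_ne l [] with rfl | hl
    · simp [cyl_nil]
    · exact hinv l hl
  have h2 : shift ⁻¹' cyl l = ⋃ a, cyl (a :: l) := by
    ext x; simp [mem_cyl_cons]
  rw [h1, h2, measure_iUnion _ fun a => measurableSet_cyl _, tsum_fintype,
    ENNReal.toReal_sum fun a _ => measure_ne_top _ _]
  intro a b hab
  refine Set.disjoint_left.2 fun x hx hx' => hab ?_
  exact (mem_cyl_cons.1 hx).1.symm.trans (mem_cyl_cons.1 hx').1

lemma sum_measureReal_cyl [Fintype I] {μ : Measure (ℕ → I)} [IsProbabilityMeasure μ]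
    (hinv : IsShiftInvariant μ) (n : ℕ) :
    ∑ f : Fin n → I, (μ (cyl (List.ofFn f))).toReal = 1 := by
  induction n with
  | zero => simp [cyl_nil]
  | succ n ih =>
    rw [sum_ofFn_succ n (fun l => (μ (cyl l)).toReal), Finset.sum_comm]
    simpa only [sum_measureReal_cyl_cons hinv] using ih

open Classical in
lemma sum_measureReal_cyl_of_no_prefix_le [Fintype I] {μ : Measure (ℕ → I)}
    [IsProbabilityMeasure μ] (S : Finset (List I)) (n : ℕ) (hn : ∀ w ∈ S, w.length ≤ n) :
    ∑ f : Fin n → I, (if ∃ w ∈ S, w <+: List.ofFn f then 0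
      else (μ (cyl (List.ofFn f))).toReal) ≤ (μ (⋃ w ∈ S, cyl w)ᶜ).toReal := by
  have h1 : ∑ f : Fin n → I, (if ∃ w ∈ S, w <+: List.ofFn f then 0
      else (μ (cyl (List.ofFn f))).toReal) =
      ∑ f : Fin n → I with ¬ ∃ w ∈ S, w <+: List.ofFn f, (μ (cyl (List.ofFn f))).toReal := by
    rw [Finset.sum_filter]
    refine Finset.sum_congr rfl fun f _ => ?_
    rw [ite_not]
  rw [h1, ← ENNReal.toReal_sum fun a _ => measure_ne_top _ _,
    ← measure_biUnion_finset _ fun f _ => measurableSet_cyl _]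
  · refine ENNReal.toReal_mono (measure_ne_top _ _) (measure_mono ?_)
    intro x hx hx'
    simp only [Set.mem_iUnion, Finset.mem_filter, exists_prop] at hx hx'
    obtain ⟨f, ⟨_, hf⟩, hxf⟩ := hx
    obtain ⟨w, hw, hxw⟩ := hx'
    exact hf ⟨w, hw, prefix_of_mem_cyl hxw hxf (by simpa using hn w hw)⟩
  · intro f _ g _ hfg
    refine Set.disjoint_left.2 fun x hx hx' => hfg (funext fun k => ?_)
    exact (mem_cyl_ofFn.1 hx k).symm.trans (mem_cyl_ofFn.1 hx' k)

end cylinders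

section equilibrium

variable {I : Type*}

open scoped ENNReal

namespace CylFun

/-- The submultiplicative weight `K_t ψ_w^t(h)`, normalised to `1` on the empty word. -/
noncomputable def weight (C : CylFun I) (t : ℝ) (h : ℕ → I) : List I → ℝ
  | [] => 1
  | a :: w => C.K t * C.ψ t (a :: w) h

lemma weight_of_ne_nil (C : CylFun I) (t : ℝ) (h : ℕ → I) {w : List I} (hw : w ≠ []) :
    C.weight t h w = C.K t * C.ψ t w h := by
  cases w with
  | nil => exact absurd rfl hw
  | cons a w => rfl

lemma K_pos (C : CylFun I) {t : ℝ} (ht : 0 ≤ t) : 0 < C.K t :=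
  one_pos.trans_le (C.one_le_K t ht)

lemma weight_pos (C : CylFun I) {t : ℝ} (ht : 0 ≤ t) (h : ℕ → I) (w : List I) :
    0 < C.weight t h w := by
  rcases eq_or_ne w [] with rfl | hw
  · exact one_pos
  · rw [C.weight_of_ne_nil t h hw]
    exact mul_pos (C.K_pos ht) (C.pos t ht w hw h)

lemma weight_append_le (C : CylFun I) {t : ℝ} (ht : 0 ≤ t) (h : ℕ → I) (u v : List I) :
    C.weight t h (u ++ v) ≤ C.weight t h u * C.weight t h v := by
  rcases eq_or_ne u [] with rfl | hu
  · simp [weight]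
  rcases eq_or_ne v [] with rfl | hv
  · simp [weight]
  have huv : u ++ v ≠ [] := by simp [hu]
  rw [C.weight_of_ne_nil t h hu, C.weight_of_ne_nil t h hv, C.weight_of_ne_nil t h huv]
  have h1 := C.subchain t ht (u ++ v) u.length (List.length_pos_iff.2 hu)
    (by simpa using List.length_pos_iff.2 hv) h
  rw [List.take_left, List.drop_left] at h1
  have h2 := mul_le_mul_of_nonneg_right (C.bvp t ht u hu (wcat v h) h) (C.pos t ht v hv h).le
  calc C.K t * C.ψ t (u ++ v) h ≤ C.K t * (C.K t * C.ψ t u h * C.ψ t v h) :=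
        mul_le_mul_of_nonneg_left (h1.trans h2) (C.K_pos ht).le
    _ = _ := by ring

end CylFun

lemma Gpre_mono (C : CylFun I) (t : ℝ) (h : ℕ → I) {m n : ℕ} (hmn : m ≤ n)
    (A : Set (ℕ → I)) : Gpre C t h m A ≤ Gpre C t h n A := by
  refine le_iInf fun c => le_iInf fun hc => le_iInf fun hl => ?_
  exact iInf_le_of_le c (iInf_le_of_le hc (iInf_le_of_le (fun j => hmn.trans (hl j)) le_rfl))

lemma Gmeas_eq_zero_of_sum_le [Fintype I] [Nonempty I] (C : CylFun I) {s : ℝ} (hs : 0 ≤ s)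
    (h : ℕ → I) {ρ : ℝ} (hρ0 : 0 ≤ ρ) (hρ : ρ < 1)
    (hsum : ∀ᶠ n : ℕ in atTop, ∑ f : Fin n → I, C.ψ s (List.ofFn f) h ≤ ρ ^ n)
    (A : Set (ℕ → I)) : Gmeas C s h A = 0 := by
  obtain ⟨N, hN⟩ := eventually_atTop.1 hsum
  have key : ∀ n, N ≤ n → 1 ≤ n →
      Gpre C s h n A ≤ ENNReal.ofReal ρ ^ n * (1 - ENNReal.ofReal ρ)⁻¹ := by
    intro n hn hn1
    have : Infinite (Σ k : ℕ, Fin (n + k) → I) :=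
      Infinite.of_surjective (Sigma.fst) fun k => ⟨⟨k, fun _ => Classical.arbitrary I⟩, rfl⟩
    obtain ⟨e⟩ := nonempty_equiv_of_countable (α := ℕ) (β := Σ k : ℕ, Fin (n + k) → I)
    refine iInf_le_of_le (fun j => List.ofFn (e j).2) (iInf_le_of_le ?_ (iInf_le_of_le ?_ ?_))
    · intro x _
      obtain ⟨j, hj⟩ := e.surjective ⟨0, fun k => x k⟩
      refine Set.mem_iUnion.2 ⟨j, ?_⟩
      change x ∈ cyl (List.ofFn (e j).2)
      rw [hj]
      exact mem_cyl_ofFn.2 fun k => rfl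
    · intro j
      simp
    · rw [e.tsum_eq (fun q : Σ k : ℕ, Fin (n + k) → I =>
        ENNReal.ofReal (C.ψ s (List.ofFn q.2) h)), ENNReal.tsum_sigma']
      rw [← ENNReal.tsum_geometric, ← ENNReal.tsum_mul_left]
      refine ENNReal.tsum_le_tsum fun k => ?_
      rw [tsum_fintype, ← ENNReal.ofReal_sum_of_nonneg, ← pow_add, ← ENNReal.ofReal_pow hρ0]
      · exact ENNReal.ofReal_le_ofReal (hN (n + k) (by omega))
      · intro f _
        refine (C.pos s hs _ ?_ h).le
        rw [← List.length_pos_iff]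
        simp
        omega
  have hlim : Tendsto (fun n : ℕ => ENNReal.ofReal ρ ^ n * (1 - ENNReal.ofReal ρ)⁻¹)
      atTop (𝓝 0) := by
    have h1 : ENNReal.ofReal ρ < 1 := by simpa using hρ
    have h2 := ENNReal.Tendsto.mul_const (b := (1 - ENNReal.ofReal ρ)⁻¹)
      (ENNReal.tendsto_pow_atTop_nhds_zero_of_lt_one h1)
      (Or.inr (ENNReal.inv_ne_top.2 (tsub_pos_of_lt h1).ne'))
    simpa using h2
  refine le_antisymm (iSup_le fun m => ?_) zero_le
  refine ge_of_tendsto hlim ?_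
  filter_upwards [eventually_ge_atTop (max m (max N 1))] with n hn
  exact (Gpre_mono C s h (by omega) A).trans (key n (by omega) (by omega))

lemma Gmeas_eq_zero_of_pressure [Fintype I] [Nonempty I] (C : CylFun I) {t s : ℝ}
    (ht : 0 ≤ t) (hts : t < s) (h : ℕ → I) (hP : Tendsto (presSeq C t h) atTop (𝓝 0))
    (A : Set (ℕ → I)) : Gmeas C s h A = 0 := by
  set q : ℝ := -((s - t) * Real.log C.shi) / 2 with hq
  have hq0 : 0 < q := by
    have := mul_neg_of_pos_of_neg (sub_pos.2 hts) (Real.log_neg C.shi_pos C.shi_lt_one)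
    rw [hq]; linarith
  refine Gmeas_eq_zero_of_sum_le C (ht.trans hts.le) h (Real.exp_pos (-q)).le
    (by rw [Real.exp_lt_one_iff]; linarith) ?_ A
  filter_upwards [hP.eventually_le_const hq0, eventually_ge_atTop 1] with n hn hn1
  have hn0 : (0 : ℝ) < n := by exact_mod_cast hn1
  have hZ : ∑ f : Fin n → I, C.ψ t (List.ofFn f) h ≤ Real.exp (n * q) := by
    refine (Real.le_exp_log _).trans (Real.exp_le_exp.2 ?_)
    rw [presSeq, inv_mul_le_iff₀ hn0] at hn
    exact hn
  calc ∑ f : Fin n → I, C.ψ s (List.ofFn f) h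
      ≤ ∑ f : Fin n → I, C.ψ t (List.ofFn f) h * Real.exp (-(2 * q) * n) := by
        refine Finset.sum_le_sum fun f _ => ?_
        have h1 := C.param_le t ht (s - t) (sub_pos.2 hts).le (List.ofFn f)
          (by rw [← List.length_pos_iff]; simpa using Nat.pos_of_ne_zero (by omega)) h
        rw [Real.rpow_def_of_pos C.shi_pos, List.length_ofFn, add_sub_cancel] at h1
        have h2 : -(2 * q) * n = Real.log C.shi * ((s - t) * n) := by rw [hq]; ring
        rwa [h2]
    _ ≤ Real.exp (n * q) * Real.exp (-(2 * q) * n) := by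
        rw [← Finset.sum_mul]
        exact mul_le_mul_of_nonneg_right hZ (Real.exp_pos _).le
    _ = Real.exp (-q) ^ n := by
        rw [← Real.exp_add, ← Real.exp_nat_mul]
        congr 1; ring

/-- A set with `G^s(A) = 0` is covered up to `ε` by finitely many cylinders of small total
`s`-weight. -/
lemma exists_finset_cover [MeasurableSpace I] [DiscreteMeasurableSpace I] (C : CylFun I)
    {s : ℝ} (hs : 0 ≤ s) (h : ℕ → I) (μ : Measure (ℕ → I)) [IsProbabilityMeasure μ]
    {A : Set (ℕ → I)} (hA : μ A = 1) (hG : Gmeas C s h A = 0)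
    {η ε : ℝ} (hη : 0 < η) (hε : 0 < ε) :
    ∃ S : Finset (List I), (∀ w ∈ S, w ≠ []) ∧ ∑ w ∈ S, C.ψ s w h ≤ η ∧
      (μ (⋃ w ∈ S, cyl w)ᶜ).toReal ≤ ε := by
  classical
  have h1 : Gpre C s h 1 A < ENNReal.ofReal η := by
    have : Gpre C s h 1 A ≤ 0 := hG ▸ le_iSup (fun n => Gpre C s h n A) 1
    exact this.trans_lt (ENNReal.ofReal_pos.2 hη)
  simp only [Gpre, iInf_lt_iff] at h1
  obtain ⟨c, hc, hl, hlt⟩ := h1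
  have hne : ∀ j, c j ≠ [] := fun j => List.length_pos_iff.1 (hl j)
  have hU : μ (⋃ j, cyl (c j)) = 1 :=
    le_antisymm prob_le_one (hA ▸ measure_mono hc)
  have hlim := tendsto_measure_iUnion_accumulate (μ := μ) (f := fun j => cyl (c j))
  rw [hU] at hlim
  have hlim' : Tendsto (fun n => (μ (Set.accumulate (fun j => cyl (c j)) n)).toReal) atTop
      (𝓝 1) := by
    exact (ENNReal.tendsto_toReal ENNReal.one_ne_top).comp hlim
  obtain ⟨J, hJ⟩ := (hlim'.eventually_const_le (sub_lt_self 1 hε)).exists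
  refine ⟨(Finset.range (J + 1)).image c, ?_, ?_, ?_⟩
  · intro w hw
    obtain ⟨j, _, rfl⟩ := Finset.mem_image.1 hw
    exact hne j
  · refine (Finset.sum_image_le_of_nonneg ?_).trans ?_
    · intro w hw
      obtain ⟨j, _, rfl⟩ := Finset.mem_image.1 hw
      exact (C.pos s hs _ (hne j) h).le
    · have h2 : ENNReal.ofReal (∑ j ∈ Finset.range (J + 1), C.ψ s (c j) h) ≤
          ENNReal.ofReal η := by
        rw [ENNReal.ofReal_sum_of_nonneg fun j _ => (C.pos s hs _ (hne j) h).le]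
        exact (ENNReal.sum_le_tsum _).trans hlt.le
      exact (ENNReal.ofReal_le_ofReal_iff hη.le).1 h2
  · have h3 : (⋃ w ∈ (Finset.range (J + 1)).image c, cyl w) =
        Set.accumulate (fun j => cyl (c j)) J := by
      ext x
      simp [Set.mem_accumulate]
    have hmeas : MeasurableSet (Set.accumulate (fun j => cyl (c j)) J) := by
      rw [← h3]
      exact Finset.measurableSet_biUnion _ fun w _ => measurableSet_cyl w
    rw [h3, prob_compl_eq_one_sub hmeas, ENNReal.toReal_sub_of_le prob_le_one ENNReal.one_ne_top]
    simp only [ENNReal.toReal_one]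
    linarith

lemma Gmeas_ne_zero_of_equilibrium [Fintype I] [Nonempty I] [MeasurableSpace I]
    [DiscreteMeasurableSpace I] (C : CylFun I) {s t : ℝ} (hs : 0 ≤ s) (hst : s < t)
    (h : ℕ → I) (μ : Measure (ℕ → I)) [IsProbabilityMeasure μ] (hinv : IsShiftInvariant μ)
    {H E : ℝ} (hH : Tendsto (entSeq μ) atTop (𝓝 H)) (hE : Tendsto (enSeq μ C t h) atTop (𝓝 E))
    (hequil : 0 = H + E) {A : Set (ℕ → I)} (hA : μ A = 1) : Gmeas C s h A ≠ 0 := by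
  intro hG
  have ht : 0 ≤ t := hs.trans hst.le
  have hK := C.K_pos ht
  set D : ℝ := (C.shi ^ (t - s))⁻¹ with hD
  have hx0 : 0 < C.shi ^ (t - s) := Real.rpow_pos_of_pos C.shi_pos _
  have hD0 : 0 < D := inv_pos.2 hx0
  have hD1 : 1 < D := (one_lt_inv₀ hx0).2
    (Real.rpow_lt_one C.shi_pos.le C.shi_lt_one (sub_pos.2 hst))
  have hlogD : 0 < Real.log D := Real.log_pos hD1
  set b : ℝ := (2 * Fintype.card I : ℝ)⁻¹ with hb
  have hcard : (0 : ℝ) < Fintype.card I := by exact_mod_cast Fintype.card_pos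
  have hb0 : 0 < b := by positivity
  have hp := C.weight_pos ht h
  set R : ℝ := 1 + ∑ i : I, C.weight t h [i] * D / b with hR
  have hterm : ∀ i : I, 0 ≤ C.weight t h [i] * D / b := fun i =>
    (div_pos (mul_pos (hp _) hD0) hb0).le
  have hR1 : 1 ≤ R := le_add_of_nonneg_right (Finset.sum_nonneg fun i _ => hterm i)
  have hR0 : 0 < R := one_pos.trans_le hR1
  have hr : ∀ i : I, C.weight t h [i] * D * R⁻¹ ≤ b := by
    intro i
    have h1 : C.weight t h [i] * D / b ≤ R :=
      (Finset.single_le_sum (fun i _ => hterm i) (Finset.mem_univ i)).trans (by linarith)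
    rw [div_le_iff₀ hb0] at h1
    rw [← div_eq_mul_inv, div_le_iff₀ hR0]
    linarith
  set ε : ℝ := Real.log D / (2 * (1 + Real.log R)) with hε
  have hlogR : 0 ≤ Real.log R := Real.log_nonneg hR1
  have hε0 : 0 < ε := by positivity
  obtain ⟨S, hSne, hSsum, hSμ⟩ := exists_finset_cover C hs h μ hA hG
    (η := (2 * C.K t)⁻¹) (by positivity) hε0
  have hab : Fintype.card I * b + ∑ w ∈ S, C.weight t h w * D ^ w.length ≤ 1 := by
    have h1 : Fintype.card I * b = 1 / 2 := by rw [hb]; field_simp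
    have h2 : ∑ w ∈ S, C.weight t h w * D ^ w.length ≤ ∑ w ∈ S, C.K t * C.ψ s w h := by
      refine Finset.sum_le_sum fun w hw => ?_
      rw [C.weight_of_ne_nil t h (hSne w hw), mul_assoc]
      refine mul_le_mul_of_nonneg_left ?_ hK.le
      have h3 := C.param_le s hs (t - s) (sub_pos.2 hst).le w (hSne w hw) h
      rw [add_sub_cancel, Real.rpow_mul C.shi_pos.le, Real.rpow_natCast] at h3
      rw [hD, inv_pow, ← div_eq_mul_inv, div_le_iff₀ (pow_pos hx0 _)]
      exact h3
    rw [← Finset.mul_sum] at h2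
    have h3 := mul_le_mul_of_nonneg_left hSsum hK.le
    have h4 : C.K t * (2 * C.K t)⁻¹ = 1 / 2 := by field_simp
    linarith
  set M : ℕ := S.sup List.length with hM
  have hmain := sum_log_le_of_parse (m := fun l => (μ (cyl l)).toReal) (p := C.weight t h)
    (D := D) (r := R⁻¹) (b := b) (ε := ε) (M := M) (S := S)
    (fun l => ENNReal.toReal_nonneg) (sum_measureReal_cyl hinv)
    (sum_measureReal_cyl_cons hinv) hε0.le
    (fun n hn => (sum_measureReal_cyl_of_no_prefix_le S n fun w hw =>
      (Finset.le_sup (f := List.length) hw).trans hn).trans hSμ)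
    hp rfl (C.weight_append_le ht h) hD0 (inv_pos.2 hR0) (inv_le_one_of_one_le₀ hR1) hr hb0.le
    hSne hab
  have hn : ∀ᶠ n : ℕ in atTop, enSeq μ C t h n + (n : ℝ)⁻¹ * (Real.log (C.K t) -
      Real.log R * M) + (Real.log D - Real.log R * ε) ≤ -entSeq μ n := by
    filter_upwards [eventually_ge_atTop 1] with n hn1
    have hn0 : (0 : ℝ) < n := by exact_mod_cast hn1
    have h1 := hmain n
    have h2 : ∑ f : Fin n → I, (μ (cyl (List.ofFn f))).toReal *
        Real.log (C.weight t h (List.ofFn f)) =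
        Real.log (C.K t) + ∑ f : Fin n → I, (μ (cyl (List.ofFn f))).toReal *
          Real.log (C.ψ t (List.ofFn f) h) := by
      have h3 : ∀ f : Fin n → I, (μ (cyl (List.ofFn f))).toReal *
          Real.log (C.weight t h (List.ofFn f)) =
          (μ (cyl (List.ofFn f))).toReal * Real.log (C.K t) +
          (μ (cyl (List.ofFn f))).toReal * Real.log (C.ψ t (List.ofFn f) h) := by
        intro f
        have hne : List.ofFn f ≠ [] := by
          rw [← List.length_pos_iff]
          simpa using Nat.pos_of_ne_zero (by omega)
        rw [C.weight_of_ne_nil t h hne, Real.log_mul hK.ne' (C.pos t ht _ hne h).ne', mul_add]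
      simp only [h3, Finset.sum_add_distrib, ← Finset.sum_mul, sum_measureReal_cyl hinv, one_mul]
    rw [h2, Real.log_inv R] at h1
    have h3 := mul_le_mul_of_nonneg_left h1 (inv_pos.2 hn0).le
    rw [entSeq, enSeq, neg_neg]
    refine le_trans (le_of_eq ?_) h3
    field_simp
    ring
  have hlim : Tendsto (fun n : ℕ => enSeq μ C t h n + (n : ℝ)⁻¹ * (Real.log (C.K t) -
      Real.log R * M) + (Real.log D - Real.log R * ε)) atTop
      (𝓝 (E + 0 * (Real.log (C.K t) - Real.log R * M) + (Real.log D - Real.log R * ε))) :=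
    (hE.add (tendsto_inv_atTop_nhds_zero_nat.mul_const _)).add_const _
  have hfin := le_of_tendsto_of_tendsto hlim hH.neg hn
  have hεR : Real.log R * ε < Real.log D := by
    have h1 : ε * (2 * (1 + Real.log R)) = Real.log D := by
      rw [hε]; field_simp
    nlinarith [mul_nonneg hε0.le hlogR]
  linarith

end equilibrium

/-- If `P(t) = 0` and `μ` is an ergodic `t`-equilibrium measure, then
`dim_ψ(I^∞) = t` and every Borel set `A` of full `μ`-measure satisfies
`dim_ψ(A) = dim_ψ(I^∞) = t`. -/
theorem full_equilibrium_dimension {I : Type*} [Fintype I] [MeasurableSpace I]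
    [DiscreteMeasurableSpace I] (hcard : 2 ≤ Fintype.card I)
    (C : CylFun I) (t : ℝ) (ht : 0 ≤ t) (h : ℕ → I)
    (μ : Measure (ℕ → I)) [IsProbabilityMeasure μ]
    (hinv : IsShiftInvariant μ) (herg : IsShiftErgodic μ) (H E : ℝ)
    (hP : Tendsto (presSeq C t h) atTop (𝓝 0))
    (hH : Tendsto (entSeq μ) atTop (𝓝 H))
    (hE : Tendsto (enSeq μ C t h) atTop (𝓝 E))
    (hequil : (0 : ℝ) = H + E) :
    eqDim C h (Set.univ : Set (ℕ → I)) = t ∧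
    ∀ A : Set (ℕ → I), MeasurableSet A → μ A = 1 →
      eqDim C h A = t := by
  have : Nonempty I := Fintype.card_pos_iff.1 (by omega)
  have key : ∀ A : Set (ℕ → I), μ A = 1 → eqDim C h A = t := by
    intro A hA
    refine csInf_eq_of_forall_ge_of_forall_gt_exists_lt ?_ ?_ ?_
    · exact ⟨t + 1, by linarith, Gmeas_eq_zero_of_pressure C ht (by linarith) h hP A⟩
    · rintro s ⟨hs, hG⟩
      by_contra! hst
      exact Gmeas_ne_zero_of_equilibrium C hs hst h μ hinv hH hE hequil hA hG
    · intro s hs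
      obtain ⟨u, htu, hus⟩ := exists_between hs
      exact ⟨u, ⟨by linarith, Gmeas_eq_zero_of_pressure C ht htu h hP A⟩, hus⟩
  exact ⟨key _ measure_univ, fun A _ hA => key A hA⟩
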